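/- Let R be a commutative ring, let φ : R^m → R^n be an R-linear map, let d ≥ 1, and let r ≥ 1. Let Σ be the set of minimal elements, with respect to the partial order on Young diagrams, among the shapes of the monomials generating the monomial ideal I_r(S^d(Y)), where Y is a diagonal matrix of indeterminates of the same format as φ. Then the integral closure of the ideal I_r(S^d(φ)) equals the integral closure of the ideal Σ_{σ ∈ Σ} I^{(σ)}(φ). -/

import Mathlib

noncomputable section

/-- `I_t(A)`: the ideal of `R` generated by the `t × t` minors of the matrix `A`. -/
def minorsIdeal {R : Type*} [CommRing R] (t : ℕ) {N M : Type*} (A : Matrix N M R) : Ideal R :=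
  Ideal.span {x : R | ∃ (r : Fin t → N) (c : Fin t → M), x = (A.submatrix r c).det}

/-- The matrix (in the standard bases of monomials) of the `d`-th symmetric power
`S^d(φ) : S^d(R^m) → S^d(R^n)` of the linear map `φ : R^m → R^n` given by the
`n × m` matrix `A`: the `(μ, ν)` entry is the coefficient of the monomial `x^μ` in
`Π_{j ∈ ν} φ(x_j)`, computed in the symmetric algebra `R[x_1, …, x_n]` of `R^n`. -/
def symPowMatrix {R : Type*} [CommRing R] {m n : ℕ} (d : ℕ) (A : Matrix (Fin n) (Fin m) R) :
    Matrix (Sym (Fin n) d) (Sym (Fin m) d) R := fun μ ν =>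
  MvPolynomial.coeff (Multiset.toFinsupp (μ : Multiset (Fin n)))
    (((ν : Multiset (Fin m)).map fun j =>
        ∑ i : Fin n, MvPolynomial.C (A i j) * MvPolynomial.X i).prod)

/-- The integral closure of an ideal `I ⊆ R`: the set of `x ∈ R` satisfying an equation
`x^k + a_1 x^{k-1} + ⋯ + a_k = 0` with `a_i ∈ I^i` for all `i`. -/
def Ideal.intClosure {R : Type*} [CommRing R] (I : Ideal R) : Set R :=
  {x : R | ∃ k : ℕ, 0 < k ∧ ∃ a : ℕ → R, (∀ i ∈ Finset.Icc 1 k, a i ∈ I ^ i) ∧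
      x ^ k + ∑ i ∈ Finset.Icc 1 k, a i * x ^ (k - i) = 0}

/-- A Young diagram `σ = (s_1, …, s_u)`, recorded as the multiset of its (positive) parts. -/
def IsYoungDiagram (σ : Multiset ℕ) : Prop := ∀ s ∈ σ, 0 < s

/-- `γ_j(σ) = Σ_i max (0, s_i - j + 1)` (written with truncated subtraction). -/
def youngGamma (σ : Multiset ℕ) (j : ℕ) : ℕ := (σ.map fun s => s + 1 - j).sum

/-- The partial order on Young diagrams: `σ ≤ τ` iff `γ_j σ ≤ γ_j τ` for all `j ≥ 1`. -/
def YoungLE (σ τ : Multiset ℕ) : Prop := ∀ j, 1 ≤ j → youngGamma σ j ≤ youngGamma τ j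

/-- `I^σ(A) = Π_i I_{s_i}(A)`. -/
def prodMinorsIdeal {R : Type*} [CommRing R] {N M : Type*} (A : Matrix N M R)
    (σ : Multiset ℕ) : Ideal R := (σ.map fun s => minorsIdeal s A).prod

/-- The shape of the monomial with exponent vector `e`: writing the monomial `f` as
`f = f_1 ⋯ f_u` with each `f_i` squarefree and `f_{i+1} ∣ f_i`, the shape is
`(deg f_1, …, deg f_u)`, where `deg f_i = #{j | e j ≥ i}`. -/
def monomialShape {k : ℕ} (e : Fin k →₀ ℕ) : Multiset ℕ :=
  Multiset.filter (fun c => 0 < c)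
    ((Multiset.range (e.sum fun _ v => v)).map fun i =>
      (Finset.univ.filter fun j => i + 1 ≤ e j).card)

/-- `I^{(σ)}(A) = Σ_{τ ≥ σ} I^τ(A)`, the sum over all Young diagrams `τ ≥ σ`. -/
def sumProdMinorsIdeal {R : Type*} [CommRing R] {N M : Type*} (A : Matrix N M R)
    (σ : Multiset ℕ) : Ideal R :=
  ⨆ (τ : Multiset ℕ) (_ : IsYoungDiagram τ ∧ YoungLE σ τ), prodMinorsIdeal A τ

/-- The `n × m` diagonal matrix whose diagonal entries are independent indeterminates
`Y_1, …, Y_{min n m}` over `ℤ` (and whose other entries are zero). -/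
def diagIndetMatrix (n m : ℕ) : Matrix (Fin n) (Fin m) (MvPolynomial (Fin (min n m)) ℤ) :=
  fun i j => if h : (i : ℕ) = (j : ℕ) then
      MvPolynomial.X ⟨(i : ℕ), lt_min i.isLt (h ▸ j.isLt)⟩
    else 0

/-- The set of shapes of the monomials lying in the monomial ideal `I_r(S^d(Y))`,
where `Y` is an `n × m` diagonal matrix of indeterminates over `ℤ`. -/
def shapesOfSymPowMinors (n m d r : ℕ) : Set (Multiset ℕ) :=
  {σ | ∃ e : Fin (min n m) →₀ ℕ,
      MvPolynomial.monomial e (1 : ℤ) ∈ minorsIdeal r (symPowMatrix d (diagIndetMatrix n m)) ∧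
      σ = monomialShape e}

/-- `Σ`: the set of minimal elements, with respect to the partial order on Young diagrams,
among the shapes of the monomials generating the monomial ideal `I_r(S^d(Y))`. -/
def minimalShapes (n m d r : ℕ) : Set (Multiset ℕ) :=
  {σ ∈ shapesOfSymPowMinors n m d r |
    ∀ τ ∈ shapesOfSymPowMinors n m d r, YoungLE τ σ → τ = σ}

/-! ### Minors -/

section Minors

variable {R S : Type*} [CommRing R] [CommRing S] {N M L : Type*}

theorem det_submatrix_mem_minorsIdeal {t : ℕ} (A : Matrix N M R) (r : Fin t → N) (c : Fin t → M) :
    (A.submatrix r c).det ∈ minorsIdeal t A :=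
  Ideal.subset_span ⟨r, c, rfl⟩

theorem minorsIdeal_zero (A : Matrix N M R) : minorsIdeal 0 A = ⊤ := by
  rw [Ideal.eq_top_iff_one]
  simpa using det_submatrix_mem_minorsIdeal A (t := 0) Fin.elim0 Fin.elim0

theorem minorsIdeal_le {t : ℕ} {A : Matrix N M R} {I : Ideal R}
    (h : ∀ (r : Fin t → N) (c : Fin t → M), (A.submatrix r c).det ∈ I) : minorsIdeal t A ≤ I := by
  refine Ideal.span_le.2 ?_
  rintro _ ⟨r, c, rfl⟩
  exact h r c

theorem map_minorsIdeal (f : R →+* S) (t : ℕ) (A : Matrix N M R) :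
    (minorsIdeal t A).map f = minorsIdeal t (A.map f) := by
  rw [minorsIdeal, minorsIdeal, Ideal.map_span]
  congr 1
  ext x
  constructor
  · rintro ⟨_, ⟨r, c, rfl⟩, rfl⟩
    exact ⟨r, c, by rw [RingHom.map_det]; rfl⟩
  · rintro ⟨r, c, rfl⟩
    exact ⟨_, ⟨r, c, rfl⟩, by rw [RingHom.map_det]; rfl⟩

theorem minorsIdeal_transpose (t : ℕ) (A : Matrix N M R) :
    minorsIdeal t A.transpose = minorsIdeal t A := by
  apply le_antisymm <;> refine minorsIdeal_le fun r c => ?_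
  · rw [← Matrix.det_transpose]
    exact det_submatrix_mem_minorsIdeal A c r
  · rw [← Matrix.det_transpose]
    exact det_submatrix_mem_minorsIdeal A.transpose c r

theorem minorsIdeal_mul_le_right [Fintype M] (t : ℕ) (P : Matrix N M R) (A : Matrix M L R) :
    minorsIdeal t (P * A) ≤ minorsIdeal t A := by
  classical
  refine minorsIdeal_le fun r c => ?_
  have h : ((P * A).submatrix r c).det =
      ∑ s : Fin t → M, (∏ i, P (r i) (s i)) * (A.submatrix s c).det := by
    have h1 : (P * A).submatrix r c =
        fun i => ∑ k, P (r i) k • (fun j => A k (c j)) := by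
      ext i j
      simp [Matrix.mul_apply, Finset.sum_apply]
    rw [h1]
    change (Matrix.detRowAlternating (n := Fin t) (R := R)).toMultilinearMap _ = _
    rw [MultilinearMap.map_sum]
    refine Finset.sum_congr rfl fun s _ => ?_
    rw [MultilinearMap.map_smul_univ]
    rfl
  rw [h]
  exact Ideal.sum_mem _ fun s _ => Ideal.mul_mem_left _ _ (det_submatrix_mem_minorsIdeal A s c)

theorem minorsIdeal_mul_le_left [Fintype M] (t : ℕ) (A : Matrix N M R) (Q : Matrix M L R) :
    minorsIdeal t (A * Q) ≤ minorsIdeal t A := by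
  rw [← minorsIdeal_transpose, Matrix.transpose_mul, ← minorsIdeal_transpose t A]
  exact minorsIdeal_mul_le_right t _ _

/-- A minor of a matrix with monomial entries and at most one nonzero entry in each column is,
up to sign, a monomial. -/
theorem det_eq_zero_or_monomial {σ : Type*} {t : ℕ} (A : Matrix N M (MvPolynomial σ R))
    (hA : ∀ i j, A i j = 0 ∨ ∃ e, A i j = MvPolynomial.monomial e 1)
    (hcol : ∀ i i' j, A i j ≠ 0 → A i' j ≠ 0 → i = i') (r : Fin t → N) (c : Fin t → M) :
    (A.submatrix r c).det = 0 ∨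
      ∃ e, ∃ u : ℤˣ, (A.submatrix r c).det = u • MvPolynomial.monomial e 1 := by
  by_cases hr : Function.Injective r
  · by_cases h : ∃ s : Equiv.Perm (Fin t), ∀ i, A (r (s i)) (c i) ≠ 0
    · obtain ⟨s, hs⟩ := h
      right
      have hmon : ∀ i, ∃ e, A (r (s i)) (c i) = MvPolynomial.monomial e 1 :=
        fun i => (hA _ _).resolve_left (hs i)
      choose e he using hmon
      refine ⟨∑ i, e i, Equiv.Perm.sign s, ?_⟩
      rw [Matrix.det_apply, Finset.sum_eq_single s]
      · congr 1
        simp only [Matrix.submatrix_apply, he]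
        rw [MvPolynomial.monomial_sum_one]
      · intro s' _ hne
        obtain ⟨i, hi⟩ : ∃ i, A (r (s' i)) (c i) = 0 := by
          by_contra! hcon
          exact hne (Equiv.ext fun i => hr (hcol _ _ _ (hcon i) (hs i)))
        rw [Finset.prod_eq_zero (Finset.mem_univ i) (by simpa using hi), smul_zero]
      · simp
    · left
      push Not at h
      rw [Matrix.det_apply]
      refine Finset.sum_eq_zero fun s _ => ?_
      obtain ⟨i, hi⟩ := h s
      rw [Finset.prod_eq_zero (Finset.mem_univ i) (by simpa using hi), smul_zero]
  · left
    rw [Function.Injective] at hr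
    push Not at hr
    obtain ⟨i, j, hij, hne⟩ := hr
    exact Matrix.det_zero_of_row_eq hne (by ext k; simp [hij])

theorem prodMinorsIdeal_mono {N' M' : Type*} {A : Matrix N M R} {B : Matrix N' M' R}
    (h : ∀ t, minorsIdeal t A ≤ minorsIdeal t B) (σ : Multiset ℕ) :
    prodMinorsIdeal A σ ≤ prodMinorsIdeal B σ := by
  unfold prodMinorsIdeal
  induction σ using Multiset.induction with
  | empty => simp
  | cons s σ ih => simpa using Ideal.mul_mono (h s) ih

theorem map_prodMinorsIdeal (f : R →+* S) (A : Matrix N M R) (σ : Multiset ℕ) :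
    (prodMinorsIdeal A σ).map f = prodMinorsIdeal (A.map f) σ := by
  unfold prodMinorsIdeal
  induction σ using Multiset.induction with
  | empty => simp [Ideal.one_eq_top, Ideal.map_top]
  | cons s σ ih => simp [Ideal.map_mul, ih, map_minorsIdeal]

theorem map_sumProdMinorsIdeal (f : R →+* S) (A : Matrix N M R) (σ : Multiset ℕ) :
    (sumProdMinorsIdeal A σ).map f = sumProdMinorsIdeal (A.map f) σ := by
  simp only [sumProdMinorsIdeal, Ideal.map_iSup, map_prodMinorsIdeal]

end Minors

/-! ### Symmetric powers -/

section SymPow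

open MvPolynomial

variable {R S : Type*} [CommRing R] [CommRing S] {n m p : ℕ}

/-- The linear form `φ(x_j)` attached to the `j`-th column of a matrix. -/
def columnForm (A : Matrix (Fin n) (Fin m) R) (j : Fin m) : MvPolynomial (Fin n) R :=
  ∑ i : Fin n, C (A i j) * X i

theorem symPowMatrix_apply (d : ℕ) (A : Matrix (Fin n) (Fin m) R) (μ : Sym (Fin n) d)
    (ν : Sym (Fin m) d) : symPowMatrix d A μ ν =
      coeff (Multiset.toFinsupp (μ : Multiset (Fin n)))
        ((ν : Multiset (Fin m)).map (columnForm A)).prod := rfl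

theorem map_symPowMatrix (f : R →+* S) (d : ℕ) (A : Matrix (Fin n) (Fin m) R) :
    (symPowMatrix d A).map f = symPowMatrix d (A.map f) := by
  ext μ ν
  have h : ∀ j, MvPolynomial.map f (columnForm A j) = columnForm (A.map f) j := by
    intro j
    simp [columnForm]
  rw [Matrix.map_apply, symPowMatrix_apply, symPowMatrix_apply, ← coeff_map,
    map_multiset_prod, Multiset.map_map]
  simp only [Function.comp_def, h]

theorem columnForm_isHomogeneous (A : Matrix (Fin n) (Fin m) R) (j : Fin m) :
    (columnForm A j).IsHomogeneous 1 :=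
  IsHomogeneous.sum _ _ _ fun i _ => by
    simpa using (isHomogeneous_C (Fin n) (A i j)).mul (isHomogeneous_X R i)

theorem prod_columnForm_isHomogeneous (A : Matrix (Fin n) (Fin m) R) (ν : Multiset (Fin m)) :
    ((ν.map (columnForm A)).prod).IsHomogeneous ν.card := by
  induction ν using Multiset.induction with
  | empty => simpa using isHomogeneous_one (Fin n) R
  | cons j ν ih =>
    simpa [add_comm] using (columnForm_isHomogeneous A j).mul ih

theorem MvPolynomial.IsHomogeneous.eq_sum_sym {d : ℕ} {q : MvPolynomial (Fin n) R}
    (hq : q.IsHomogeneous d) :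
    q = ∑ μ : Sym (Fin n) d, C (coeff (Multiset.toFinsupp (μ : Multiset (Fin n))) q) *
      ((μ : Multiset (Fin n)).map X).prod := by
  have hX : ∀ μ : Multiset (Fin n),
      (μ.map X).prod = monomial (Multiset.toFinsupp μ) (1 : R) := by
    intro μ
    induction μ using Multiset.induction with
    | empty => simp
    | cons j ν ih =>
      rw [Multiset.map_cons, Multiset.prod_cons, ih, X, monomial_mul, ← Multiset.singleton_add,
        map_add, Multiset.toFinsupp_singleton, one_mul]
  ext e
  simp only [hX, C_mul_monomial, mul_one, coeff_sum, coeff_monomial]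
  by_cases he : coeff e q = 0
  · rw [he]
    symm
    refine Finset.sum_eq_zero fun μ _ => ?_
    split_ifs with h
    · rw [h, he]
    · rfl
  · have hdeg : (Finsupp.toMultiset e).card = d := by
      have := hq he
      rw [← this, Finsupp.card_toMultiset, Finsupp.weight_apply]
      simp [Finsupp.sum]
    obtain ⟨κ, hκ⟩ : ∃ κ : Sym (Fin n) d, (κ : Multiset (Fin n)) = Finsupp.toMultiset e :=
      ⟨⟨Finsupp.toMultiset e, hdeg⟩, rfl⟩
    rw [Finset.sum_eq_single κ]
    · simp [hκ]
    · intro μ _ hne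
      rw [if_neg]
      intro h
      apply hne
      apply Subtype.ext
      change (μ : Multiset (Fin n)) = (κ : Multiset (Fin n))
      simp [hκ, ← h]
    · simp

theorem symPowMatrix_mul (d : ℕ) (A : Matrix (Fin n) (Fin m) R) (B : Matrix (Fin m) (Fin p) R) :
    symPowMatrix d (A * B) = symPowMatrix d A * symPowMatrix d B := by
  ext μ ν
  have hcol : ∀ j, columnForm (A * B) j = aeval (columnForm A) (columnForm B j) := by
    intro j
    simp only [columnForm, map_sum, map_mul, aeval_X, algHom_C, Matrix.mul_apply,
      Finset.mul_sum, Finset.sum_mul]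
    rw [Finset.sum_comm]
    refine Finset.sum_congr rfl fun i _ => Finset.sum_congr rfl fun k _ => ?_
    rw [algebraMap_eq]
    ring
  have hB := prod_columnForm_isHomogeneous B (ν : Multiset (Fin p))
  rw [show Multiset.card (ν : Multiset (Fin p)) = d from ν.2] at hB
  rw [symPowMatrix_apply, Matrix.mul_apply]
  simp only [hcol]
  have h2 : ((ν : Multiset (Fin p)).map fun j => aeval (columnForm A) (columnForm B j)).prod =
      aeval (columnForm A) ((ν : Multiset (Fin p)).map (columnForm B)).prod := by
    rw [map_multiset_prod, Multiset.map_map]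
    rfl
  rw [h2, hB.eq_sum_sym, map_sum, coeff_sum]
  refine Finset.sum_congr rfl fun κ _ => ?_
  rw [map_mul, map_multiset_prod, Multiset.map_map, algHom_C, algebraMap_eq, coeff_C_mul, mul_comm]
  congr 2
  simp only [Function.comp_def, aeval_X]
  rfl

theorem minorsIdeal_symPowMatrix_mul_mul_le {n' m' : ℕ} (r d : ℕ) (P : Matrix (Fin n') (Fin n) R)
    (A : Matrix (Fin n) (Fin m) R) (Q : Matrix (Fin m) (Fin m') R) :
    minorsIdeal r (symPowMatrix d (P * A * Q)) ≤ minorsIdeal r (symPowMatrix d A) := by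
  rw [symPowMatrix_mul, symPowMatrix_mul]
  exact (minorsIdeal_mul_le_left _ _ _).trans (minorsIdeal_mul_le_right _ _ _)

end SymPow

/-! ### Young diagrams -/

section Young

theorem youngGamma_add_eq_count (σ : Multiset ℕ) (s : ℕ) :
    youngGamma σ s + youngGamma σ (s + 2) = 2 * youngGamma σ (s + 1) + σ.count s := by
  induction σ using Multiset.induction with
  | empty => simp [youngGamma]
  | cons p σ ih =>
    simp only [youngGamma, Multiset.map_cons, Multiset.sum_cons, Multiset.count_cons] at ih ⊢
    split_ifs <;> omega

theorem IsYoungDiagram.eq_of_youngGamma_eq {σ τ : Multiset ℕ} (hσ : IsYoungDiagram σ)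
    (hτ : IsYoungDiagram τ) (h : ∀ j, 1 ≤ j → youngGamma σ j = youngGamma τ j) : σ = τ := by
  ext s
  rcases Nat.eq_zero_or_pos s with rfl | hs
  · rw [Multiset.count_eq_zero_of_notMem fun h0 => absurd (hσ _ h0) (lt_irrefl _),
      Multiset.count_eq_zero_of_notMem fun h0 => absurd (hτ _ h0) (lt_irrefl _)]
  · have h₁ := youngGamma_add_eq_count σ s
    have h₂ := youngGamma_add_eq_count τ s
    rw [h s hs, h (s + 1) (by omega), h (s + 2) (by omega)] at h₁
    omega

theorem youngGamma_eq_zero {σ : Multiset ℕ} {N : ℕ} (hσ : ∀ s ∈ σ, s ≤ N) {j : ℕ} (hj : N < j) :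
    youngGamma σ j = 0 := by
  rw [youngGamma, Multiset.sum_eq_zero_iff]
  simp only [Multiset.mem_map, forall_exists_index, and_imp]
  rintro _ s hs rfl
  have := hσ s hs
  omega

theorem YoungLE.refl (σ : Multiset ℕ) : YoungLE σ σ := fun _ _ => le_rfl

theorem YoungLE.trans {σ τ ρ : Multiset ℕ} (h₁ : YoungLE σ τ) (h₂ : YoungLE τ ρ) : YoungLE σ ρ :=
  fun j hj => (h₁ j hj).trans (h₂ j hj)

theorem exists_minimal_youngLE {s : Set (Multiset ℕ)} (hs : ∀ σ ∈ s, IsYoungDiagram σ)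
    {τ : Multiset ℕ} (hτ : τ ∈ s) :
    ∃ σ ∈ s, YoungLE σ τ ∧ ∀ ρ ∈ s, YoungLE ρ σ → ρ = σ := by
  classical
  obtain ⟨N, hN⟩ : ∃ N, ∀ p ∈ τ, p ≤ N :=
    ⟨τ.toFinset.sup id, fun p hp => Finset.le_sup (f := id) (Multiset.mem_toFinset.2 hp)⟩
  let size : Multiset ℕ → ℕ := fun σ => ∑ j ∈ Finset.Icc 1 N, youngGamma σ j
  obtain ⟨σ, ⟨hσs, hστ⟩, hmin⟩ := WellFounded.has_min (measure size).wf
    {σ | σ ∈ s ∧ YoungLE σ τ} ⟨τ, hτ, YoungLE.refl τ⟩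
  refine ⟨σ, hσs, hστ, fun ρ hρ hρσ => ?_⟩
  have hle : size σ ≤ size ρ := not_lt.1 (hmin ρ ⟨hρ, hρσ.trans hστ⟩)
  have heq : ∀ j ∈ Finset.Icc 1 N, youngGamma ρ j = youngGamma σ j := by
    rw [← Finset.sum_eq_sum_iff_of_le fun j hj => hρσ j (Finset.mem_Icc.1 hj).1]
    exact le_antisymm (Finset.sum_le_sum fun j hj => hρσ j (Finset.mem_Icc.1 hj).1) hle
  refine (hs ρ hρ).eq_of_youngGamma_eq (hs σ hσs) fun j hj => ?_
  by_cases hjN : j ≤ N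
  · exact heq j (Finset.mem_Icc.2 ⟨hj, hjN⟩)
  · have h0 : youngGamma τ j = 0 := youngGamma_eq_zero hN (not_le.1 hjN)
    have h₁ := hστ j hj
    have h₂ := hρσ j hj
    omega

theorem isYoungDiagram_monomialShape {k : ℕ} (e : Fin k →₀ ℕ) :
    IsYoungDiagram (monomialShape e) := fun _ hs => (Multiset.mem_filter.1 hs).2

theorem prod_map_monomialShape {M : Type*} [CommMonoid M] {k : ℕ} (e : Fin k →₀ ℕ) (f : ℕ → M)
    (hf : f 0 = 1) : ((monomialShape e).map f).prod =
      ∏ i ∈ Finset.range (e.sum fun _ v => v),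
        f (Finset.univ.filter fun j => i + 1 ≤ e j).card := by
  have h : ∀ s : Multiset ℕ, ((s.filter fun c => 0 < c).map f).prod = (s.map f).prod := by
    intro s
    induction s using Multiset.induction with
    | empty => simp
    | cons a s ih =>
      rcases Nat.eq_zero_or_pos a with rfl | ha
      · simp [ih, hf]
      · simp [ih, ha]
  rw [monomialShape, h, Multiset.map_map]
  rfl

theorem prod_pow_eq_prod_range {M : Type*} [CommMonoid M] {k : ℕ} (e : Fin k →₀ ℕ)
    (y : Fin k → M) : ∏ j, y j ^ e j =
      ∏ i ∈ Finset.range (e.sum fun _ v => v),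
        ∏ j ∈ Finset.univ.filter fun j => i + 1 ≤ e j, y j := by
  simp_rw [Finset.prod_filter]
  rw [Finset.prod_comm]
  refine Finset.prod_congr rfl fun j _ => ?_
  rw [← Finset.prod_filter, Finset.prod_const]
  congr 1
  have hj : e j ≤ e.sum fun _ v => v := by
    rw [Finsupp.sum_fintype _ _ fun _ => rfl]
    exact Finset.single_le_sum (f := fun i => e i) (fun _ _ => Nat.zero_le _) (Finset.mem_univ j)
  have : (Finset.range (e.sum fun _ v => v)).filter (fun i => i + 1 ≤ e j) =
      Finset.range (e j) := by
    ext i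
    simp only [Finset.mem_filter, Finset.mem_range]
    omega
  rw [this, Finset.card_range]

/-- Arranging the variables suitably, a monomial is determined by its shape. -/
theorem exists_perm_prod_pow_eq {M : Type*} [CommMonoid M] {k : ℕ} (e : Fin k →₀ ℕ) :
    ∃ π : Equiv.Perm (Fin k), ∀ d : ℕ → M,
      ∏ j, d (π j) ^ e j = ((monomialShape e).map fun s => ∏ j ∈ Finset.range s, d j).prod := by
  obtain ⟨ρ, hρ⟩ : ∃ ρ : Equiv.Perm (Fin k), Antitone fun j => e (ρ j) :=
    ⟨Tuple.sort fun j => OrderDual.toDual (e j),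
      fun a b hab => Tuple.monotone_sort (fun j => OrderDual.toDual (e j)) hab⟩
  refine ⟨ρ.symm, fun d => ?_⟩
  rw [prod_map_monomialShape _ _ (by simp), prod_pow_eq_prod_range]
  refine Finset.prod_congr rfl fun i _ => ?_
  have hcard : (Finset.univ.filter fun j => i + 1 ≤ e j).card =
      (Finset.univ.filter fun j => i + 1 ≤ e (ρ j)).card :=
    (Finset.card_equiv ρ (by simp)).symm
  have hle : (Finset.univ.filter fun j => i + 1 ≤ e j).card ≤ k := by
    simpa using Finset.card_filter_le (Finset.univ : Finset (Fin k)) fun j => i + 1 ≤ e j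
  refine Finset.prod_bij (fun j _ => ((ρ.symm j : Fin k) : ℕ)) ?_ ?_ ?_ ?_
  · intro j hj
    rw [Finset.mem_range, hcard, Tuple.lt_card_ge_iff_apply_ge_of_antitone hρ]
    simpa using hj
  · intro a _ b _ hab
    exact ρ.symm.injective (Fin.ext hab)
  · intro b hb
    rw [Finset.mem_range] at hb
    have hbk := hb.trans_le hle
    refine ⟨ρ ⟨b, hbk⟩, ?_, by simp⟩
    rw [hcard] at hb
    have := (Tuple.lt_card_ge_iff_apply_ge_of_antitone (j := ⟨b, hbk⟩) hρ).1 hb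
    simpa using this
  · intros
    rfl

theorem prod_prod_range_eq {M : Type*} [CommMonoid M] (q : ℕ → M) (N s : ℕ) (hs : s ≤ N) :
    ∏ j ∈ Finset.range s, ∏ l ∈ Finset.range (j + 1), q l =
      ∏ l ∈ Finset.range N, q l ^ (s + 1 - (l + 1)) := by
  induction s with
  | zero =>
    refine (Finset.prod_eq_one fun l _ => ?_).symm
    rw [show 0 + 1 - (l + 1) = 0 by omega, pow_zero]
  | succ s ih =>
    have h : (Finset.range N).filter (fun l => l < s + 1) = Finset.range (s + 1) := by
      ext l
      simp only [Finset.mem_filter, Finset.mem_range]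
      omega
    rw [Finset.prod_range_succ, ih (by omega), ← h, Finset.prod_filter, ← Finset.prod_mul_distrib]
    refine Finset.prod_congr rfl fun l _ => ?_
    split_ifs with hl
    · rw [← pow_succ]
      congr 1
      omega
    · rw [mul_one]
      congr 1
      omega

theorem youngLE_prod_dvd {M : Type*} [CommMonoid M] (q : ℕ → M) {σ τ : Multiset ℕ}
    (h : YoungLE σ τ) :
    (σ.map fun s => ∏ j ∈ Finset.range s, ∏ l ∈ Finset.range (j + 1), q l).prod ∣
      (τ.map fun s => ∏ j ∈ Finset.range s, ∏ l ∈ Finset.range (j + 1), q l).prod := by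
  have key : ∀ (ρ : Multiset ℕ) (N : ℕ), (∀ s ∈ ρ, s ≤ N) →
      (ρ.map fun s => ∏ j ∈ Finset.range s, ∏ l ∈ Finset.range (j + 1), q l).prod =
        ∏ l ∈ Finset.range N, q l ^ youngGamma ρ (l + 1) := by
    intro ρ N
    induction ρ using Multiset.induction with
    | empty => simp [youngGamma]
    | cons s ρ ih =>
      intro hN
      rw [Multiset.map_cons, Multiset.prod_cons, ih fun t ht => hN t (Multiset.mem_cons_of_mem ht),
        prod_prod_range_eq q N s (hN s (Multiset.mem_cons_self s ρ)), ← Finset.prod_mul_distrib]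
      simp only [youngGamma, Multiset.map_cons, Multiset.sum_cons, pow_add]
  obtain ⟨N, hN⟩ : ∃ N, ∀ p ∈ σ + τ, p ≤ N :=
    ⟨(σ + τ).toFinset.sup id, fun p hp => Finset.le_sup (f := id) (Multiset.mem_toFinset.2 hp)⟩
  rw [key σ N fun s hs => hN s (Multiset.mem_add.2 (.inl hs)),
    key τ N fun s hs => hN s (Multiset.mem_add.2 (.inr hs))]
  exact Finset.prod_dvd_prod_of_dvd _ _ fun l _ => pow_dvd_pow _ (h _ (by omega))

theorem prod_range_card_dvd_prod {M : Type*} [CommMonoid M] (d : ℕ → M)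
    (hd : ∀ i, d i ∣ d (i + 1)) (S : Finset ℕ) :
    ∏ j ∈ Finset.range S.card, d j ∣ ∏ j ∈ S, d j := by
  have hmono : ∀ i j, i ≤ j → d i ∣ d j := by
    intro i j hij
    induction hij with
    | refl => exact dvd_rfl
    | step _ ih => exact ih.trans (hd _)
  rw [← Fin.prod_univ_eq_prod_range, ← Finset.prod_coe_sort S,
    ← (S.orderIsoOfFin rfl).toEquiv.prod_comp]
  have hle : ∀ (i : ℕ) (hi : i < S.card), i ≤ S.orderEmbOfFin rfl ⟨i, hi⟩ := by
    intro i
    induction i with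
    | zero => exact fun _ => Nat.zero_le _
    | succ i ih =>
      intro hi
      have hlt : S.orderEmbOfFin rfl ⟨i, by omega⟩ < S.orderEmbOfFin rfl ⟨i + 1, hi⟩ :=
        (S.orderEmbOfFin rfl).strictMono (by simp)
      have := ih (by omega)
      omega
  exact Finset.prod_dvd_prod_of_dvd _ _ fun i _ => hmono _ _ (hle i i.2)

end Young

/-! ### Smith normal form over a valuation ring -/

section Smith

variable {R : Type*} [CommRing R]

/-- `B` is a two-sided multiple of `A`. -/
def IsTwoSidedMul {n m n' m' : ℕ} (A : Matrix (Fin n) (Fin m) R)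
    (B : Matrix (Fin n') (Fin m') R) : Prop :=
  ∃ (P : Matrix (Fin n') (Fin n) R) (Q : Matrix (Fin m) (Fin m') R), B = P * A * Q

variable {n m n' m' n'' m'' : ℕ}

theorem IsTwoSidedMul.trans {A : Matrix (Fin n) (Fin m) R} {B : Matrix (Fin n') (Fin m') R}
    {C : Matrix (Fin n'') (Fin m'') R} (h₁ : IsTwoSidedMul A B) (h₂ : IsTwoSidedMul B C) :
    IsTwoSidedMul A C := by
  obtain ⟨P, Q, rfl⟩ := h₁
  obtain ⟨P', Q', rfl⟩ := h₂
  exact ⟨P' * P, Q * Q', by simp only [Matrix.mul_assoc]⟩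

theorem isTwoSidedMul_submatrix (A : Matrix (Fin n) (Fin m) R) (f : Fin n' → Fin n)
    (g : Fin m' → Fin m) : IsTwoSidedMul A (A.submatrix f g) := by
  refine ⟨(1 : Matrix (Fin n) (Fin n) R).submatrix f id,
    (1 : Matrix (Fin m) (Fin m) R).submatrix id g, ?_⟩
  ext i j
  simp [Matrix.mul_apply, Matrix.one_apply]

theorem IsTwoSidedMul.minorsIdeal_le {A : Matrix (Fin n) (Fin m) R}
    {B : Matrix (Fin n') (Fin m') R} (h : IsTwoSidedMul A B) (t : ℕ) :
    minorsIdeal t B ≤ minorsIdeal t A := by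
  obtain ⟨P, Q, rfl⟩ := h
  exact (minorsIdeal_mul_le_left _ _ _).trans (minorsIdeal_mul_le_right _ _ _)

theorem IsTwoSidedMul.minorsIdeal_symPowMatrix_le {A : Matrix (Fin n) (Fin m) R}
    {B : Matrix (Fin n') (Fin m') R} (h : IsTwoSidedMul A B) (r d : ℕ) :
    minorsIdeal r (symPowMatrix d B) ≤ minorsIdeal r (symPowMatrix d A) := by
  obtain ⟨P, Q, rfl⟩ := h
  exact minorsIdeal_symPowMatrix_mul_mul_le r d P A Q

/-- The block diagonal matrix with blocks `(a)` and `B`. -/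
def cornerExtend (a : R) (B : Matrix (Fin n) (Fin m) R) :
    Matrix (Fin (n + 1)) (Fin (m + 1)) R :=
  fun i j => Fin.cases (Fin.cases a (fun _ => 0) j) (fun i' => Fin.cases 0 (fun j' => B i' j') j) i

@[simp] theorem cornerExtend_zero_zero (a : R) (B : Matrix (Fin n) (Fin m) R) :
    cornerExtend a B 0 0 = a := rfl

@[simp] theorem cornerExtend_zero_succ (a : R) (B : Matrix (Fin n) (Fin m) R) (j : Fin m) :
    cornerExtend a B 0 j.succ = 0 := rfl

@[simp] theorem cornerExtend_succ_zero (a : R) (B : Matrix (Fin n) (Fin m) R) (i : Fin n) :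
    cornerExtend a B i.succ 0 = 0 := rfl

@[simp] theorem cornerExtend_succ_succ (a : R) (B : Matrix (Fin n) (Fin m) R) (i : Fin n)
    (j : Fin m) : cornerExtend a B i.succ j.succ = B i j := rfl

theorem IsTwoSidedMul.cornerExtend {A : Matrix (Fin n) (Fin m) R}
    {B : Matrix (Fin n') (Fin m') R} (h : IsTwoSidedMul A B) (a : R) :
    IsTwoSidedMul (cornerExtend a A) (cornerExtend a B) := by
  obtain ⟨P, Q, rfl⟩ := h
  refine ⟨_root_.cornerExtend 1 P, _root_.cornerExtend 1 Q, ?_⟩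
  ext i j
  cases i using Fin.cases <;> cases j using Fin.cases <;>
    simp [Matrix.mul_apply, Fin.sum_univ_succ]

/-- The unipotent matrix clearing the first column below the corner. -/
def columnClear (c : Fin n → R) : Matrix (Fin (n + 1)) (Fin (n + 1)) R :=
  fun i j => Fin.cases (Fin.cases 1 (fun _ => 0) j)
    (fun i' => Fin.cases (c i') (fun j' => (1 : Matrix (Fin n) (Fin n) R) i' j') j) i

@[simp] theorem columnClear_zero_zero (c : Fin n → R) : columnClear c 0 0 = 1 := rfl

@[simp] theorem columnClear_zero_succ (c : Fin n → R) (j : Fin n) :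
    columnClear c 0 j.succ = 0 := rfl

@[simp] theorem columnClear_succ_zero (c : Fin n → R) (i : Fin n) :
    columnClear c i.succ 0 = c i := rfl

@[simp] theorem columnClear_succ_succ (c : Fin n → R) (i j : Fin n) :
    columnClear c i.succ j.succ = (1 : Matrix (Fin n) (Fin n) R) i j := rfl

theorem cornerExtend_isTwoSidedMul (A : Matrix (Fin (n + 1)) (Fin (m + 1)) R) (c : Fin n → R)
    (r : Fin m → R) (hc : ∀ i, A i.succ 0 = A 0 0 * c i) (hr : ∀ j, A 0 j.succ = A 0 0 * r j)
    (B : Matrix (Fin n) (Fin m) R) (hB : ∀ i j, A i.succ j.succ = B i j + A 0 0 * c i * r j) :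
    IsTwoSidedMul A (cornerExtend (A 0 0) B) ∧ IsTwoSidedMul (cornerExtend (A 0 0) B) A := by
  constructor
  · refine ⟨columnClear (-c), (columnClear (-r)).transpose, ?_⟩
    ext i j
    cases i using Fin.cases <;> cases j using Fin.cases <;>
      simp [Matrix.mul_apply, Fin.sum_univ_succ, Matrix.one_apply, hc, hr, hB]
    all_goals ring
  · refine ⟨columnClear c, (columnClear r).transpose, ?_⟩
    ext i j
    cases i using Fin.cases <;> cases j using Fin.cases <;>
      simp [Matrix.mul_apply, Fin.sum_univ_succ, Matrix.one_apply, hc, hr, hB]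
    all_goals ring

/-- The rectangular diagonal matrix with entries `d 0, d 1, …`. -/
def natDiagMatrix (n m : ℕ) (d : ℕ → R) : Matrix (Fin n) (Fin m) R :=
  fun i j => if (i : ℕ) = (j : ℕ) then d i else 0

theorem ValuationRing.exists_forall_dvd [IsDomain R] [ValuationRing R] {ι : Type*} [Fintype ι]
    [Nonempty ι] (f : ι → R) : ∃ i, ∀ j, f i ∣ f j := by
  have h : ∀ s : Finset ι, s.Nonempty → ∃ i ∈ s, ∀ j ∈ s, f i ∣ f j := by
    intro s hs
    induction hs using Finset.Nonempty.cons_induction with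
    | singleton a => exact ⟨a, by simp, by simp⟩
    | cons a s ha hs ih =>
      obtain ⟨i, hi, hmin⟩ := ih
      rcases ValuationRing.dvd_total (f a) (f i) with h | h
      · refine ⟨a, by simp, fun j hj => ?_⟩
        rcases Finset.mem_cons.1 hj with rfl | hj
        · exact dvd_rfl
        · exact h.trans (hmin j hj)
      · refine ⟨i, by simp [hi], fun j hj => ?_⟩
        rcases Finset.mem_cons.1 hj with rfl | hj
        · exact h
        · exact hmin j hj
  obtain ⟨i, -, hi⟩ := h Finset.univ Finset.univ_nonempty
  exact ⟨i, fun j => hi j (Finset.mem_univ j)⟩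

theorem ValuationRing.exists_natDiagMatrix_of_dvd [IsDomain R] [ValuationRing R] (n : ℕ) :
    ∀ (m : ℕ) (A : Matrix (Fin n) (Fin m) R) (g : R), (∀ i j, g ∣ A i j) →
      ∃ d : ℕ → R, (∀ i, d i ∣ d (i + 1)) ∧ g ∣ d 0 ∧
        IsTwoSidedMul A (natDiagMatrix n m d) ∧ IsTwoSidedMul (natDiagMatrix n m d) A := by
  induction n with
  | zero =>
    intro m A g _
    exact ⟨0, by simp, by simp, ⟨0, 0, by ext i; exact i.elim0⟩, ⟨0, 0, by ext i; exact i.elim0⟩⟩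
  | succ n ih =>
    intro m A g hg
    cases m with
    | zero =>
      exact ⟨0, by simp, by simp, ⟨0, 0, by ext i j; exact j.elim0⟩,
        ⟨0, 0, by ext i j; exact j.elim0⟩⟩
    | succ m =>
      obtain ⟨⟨i₀, j₀⟩, hmin⟩ := exists_forall_dvd fun x : Fin (n + 1) × Fin (m + 1) => A x.1 x.2
      obtain ⟨B, hB⟩ : ∃ B, B = A.submatrix (Equiv.swap 0 i₀) (Equiv.swap 0 j₀) := ⟨_, rfl⟩
      have hAB : IsTwoSidedMul A B := hB ▸ isTwoSidedMul_submatrix _ _ _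
      have hBA : IsTwoSidedMul B A := by
        have : A = B.submatrix (Equiv.swap 0 i₀) (Equiv.swap 0 j₀) := by
          ext i j
          simp [hB]
        rw [this]
        exact isTwoSidedMul_submatrix _ _ _
      have hdvd : ∀ i j, B 0 0 ∣ B i j := by
        intro i j
        simpa [hB] using hmin (Equiv.swap 0 i₀ i, Equiv.swap 0 j₀ j)
      have hgB : g ∣ B 0 0 := by
        rw [hB]
        exact hg _ _
      choose c hc using fun i : Fin n => hdvd i.succ 0
      choose r hr using fun j : Fin m => hdvd 0 j.succ
      obtain ⟨h₁, h₂⟩ := cornerExtend_isTwoSidedMul B c r hc hr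
        (fun i j => B i.succ j.succ - B 0 0 * c i * r j) (by simp)
      obtain ⟨d, hd, hd0, h₃, h₄⟩ := ih m (fun i j => B i.succ j.succ - B 0 0 * c i * r j) (B 0 0)
        fun i j => dvd_sub (hdvd _ _) ((dvd_mul_right _ _).mul_right _)
      let d' : ℕ → R := fun i => Nat.casesOn i (B 0 0) d
      have hd' : natDiagMatrix (n + 1) (m + 1) d' = cornerExtend (B 0 0) (natDiagMatrix n m d) := by
        ext i j
        cases i using Fin.cases <;> cases j using Fin.cases <;> simp [natDiagMatrix, d']
      refine ⟨d', ?_, hgB, ?_, ?_⟩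
      · rintro (_ | i)
        · exact hd0
        · exact hd i
      · rw [hd']
        exact hAB.trans (h₁.trans (h₃.cornerExtend _))
      · rw [hd']
        exact (h₄.cornerExtend _).trans (h₂.trans hBA)

/-- Smith normal form over a valuation ring; the diagonal entries are the partial products of a
sequence `q`. -/
theorem ValuationRing.exists_natDiagMatrix [IsDomain R] [ValuationRing R]
    (A : Matrix (Fin n) (Fin m) R) :
    ∃ q : ℕ → R, IsTwoSidedMul A (natDiagMatrix n m fun i => ∏ l ∈ Finset.range (i + 1), q l) ∧
      IsTwoSidedMul (natDiagMatrix n m fun i => ∏ l ∈ Finset.range (i + 1), q l) A := by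
  obtain ⟨d, hd, -, h₁, h₂⟩ := exists_natDiagMatrix_of_dvd n m A 1 fun i j => one_dvd _
  choose p hp using hd
  let q : ℕ → R := fun i => Nat.casesOn i (d 0) p
  have hq : (fun i => ∏ l ∈ Finset.range (i + 1), q l) = d := by
    funext i
    induction i with
    | zero => simp [q]
    | succ i ih => rw [Finset.prod_range_succ, ih, hp]
  exact ⟨q, by rwa [hq], by rwa [hq]⟩

end Smith

/-! ### Diagonal matrices -/

section Diagonal

open MvPolynomial

variable {R : Type*} [CommRing R] {n m : ℕ}

theorem natDiagMatrix_eq_map (d : ℕ → R) : natDiagMatrix n m d =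
    (diagIndetMatrix n m).map
      (eval₂Hom (Int.castRingHom R) fun i : Fin (min n m) => d i) := by
  ext i j
  simp only [natDiagMatrix, diagIndetMatrix, Matrix.map_apply]
  split_ifs <;> simp

theorem prod_columnForm_diagIndetMatrix (ν : Multiset (Fin m)) :
    (ν.map (columnForm (diagIndetMatrix n m))).prod = 0 ∨
      ∃ s e, (ν.map (columnForm (diagIndetMatrix n m))).prod = monomial s (monomial e 1) := by
  induction ν using Multiset.induction with
  | empty => exact .inr ⟨0, 0, by simp⟩
  | cons j ν ih =>
    rw [Multiset.map_cons, Multiset.prod_cons]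
    rcases ih with h | ⟨s, e, h⟩
    · exact .inl (by rw [h, mul_zero])
    · by_cases hj : (j : ℕ) < n
      · have hc : columnForm (diagIndetMatrix n m) j =
            monomial (Finsupp.single ⟨j, hj⟩ 1)
              (monomial (Finsupp.single ⟨j, lt_min hj j.isLt⟩ 1) 1) := by
          rw [columnForm, Finset.sum_eq_single ⟨j, hj⟩]
          · simp [diagIndetMatrix, X, C_mul_monomial]
          · intro i _ hi
            have : (i : ℕ) ≠ j := fun h => hi (Fin.ext h)
            simp [diagIndetMatrix, this]
          · simp
        right
        rw [hc, h, monomial_mul, monomial_mul, one_mul]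
        exact ⟨_, _, rfl⟩
      · left
        have hc : columnForm (diagIndetMatrix n m) j = 0 := by
          refine Finset.sum_eq_zero fun i _ => ?_
          have : (i : ℕ) ≠ j := fun h => hj (h ▸ i.isLt)
          simp [diagIndetMatrix, this]
        rw [hc, zero_mul]

theorem det_symPowMatrix_diagIndetMatrix {d t : ℕ} (r : Fin t → Sym (Fin n) d)
    (c : Fin t → Sym (Fin m) d) :
    ((symPowMatrix d (diagIndetMatrix n m)).submatrix r c).det = 0 ∨
      ∃ e, ∃ u : ℤˣ,
        ((symPowMatrix d (diagIndetMatrix n m)).submatrix r c).det = u • monomial e 1 := by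
  refine det_eq_zero_or_monomial _ ?_ ?_ r c
  · intro μ ν
    rw [symPowMatrix_apply]
    rcases prod_columnForm_diagIndetMatrix (n := n) (ν : Multiset (Fin m)) with h | ⟨s, e, h⟩
    · exact .inl (by rw [h, coeff_zero])
    · rw [h, coeff_monomial]
      split_ifs
      · exact .inr ⟨e, rfl⟩
      · exact .inl rfl
  · intro μ μ' ν hμ hμ'
    rw [symPowMatrix_apply] at hμ hμ'
    rcases prod_columnForm_diagIndetMatrix (n := n) (ν : Multiset (Fin m)) with h | ⟨s, e, h⟩
    · exact absurd (by rw [h, coeff_zero]) hμ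
    · rw [h, coeff_monomial] at hμ hμ'
      have h₁ := (ite_ne_right_iff.1 hμ).1
      have h₂ := (ite_ne_right_iff.1 hμ').1
      exact Subtype.ext (Multiset.toFinsupp.injective (h₁.symm.trans h₂))

/-- The `r`-minors of the symmetric power of a diagonal matrix are generated by the values of the
monomials in `I_r(S^d(Y))`. -/
theorem minorsIdeal_symPowMatrix_natDiagMatrix_le {d r : ℕ} (y : ℕ → R) {I : Ideal R}
    (h : ∀ e : Fin (min n m) →₀ ℕ,
      monomial e (1 : ℤ) ∈ minorsIdeal r (symPowMatrix d (diagIndetMatrix n m)) →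
        ∏ j : Fin (min n m), y j ^ e j ∈ I) :
    minorsIdeal r (symPowMatrix d (natDiagMatrix n m y)) ≤ I := by
  rw [natDiagMatrix_eq_map, ← map_symPowMatrix, ← map_minorsIdeal, Ideal.map_le_iff_le_comap]
  refine minorsIdeal_le fun a b => ?_
  have hmem := det_submatrix_mem_minorsIdeal (symPowMatrix d (diagIndetMatrix n m)) a b
  rcases det_symPowMatrix_diagIndetMatrix a b with h0 | ⟨e, u, hu⟩
  · rw [h0]
    exact Ideal.zero_mem _
  · have he : monomial e (1 : ℤ) ∈ minorsIdeal r (symPowMatrix d (diagIndetMatrix n m)) := by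
      rw [hu] at hmem
      rcases Int.units_eq_one_or u with rfl | rfl
      · simpa using hmem
      · simpa [Units.smul_def] using hmem
    have := h e he
    have hI : monomial e (1 : ℤ) ∈
        I.comap (eval₂Hom (Int.castRingHom R) fun i : Fin (min n m) => y i) := by
      rw [Ideal.mem_comap, coe_eval₂Hom, eval₂_monomial,
        Finsupp.prod_fintype _ _ fun _ => pow_zero _]
      simpa using this
    rw [hu, Units.smul_def]
    exact zsmul_mem hI _

theorem prod_pow_mem_minorsIdeal_symPowMatrix {d r : ℕ} (y : ℕ → R) {e : Fin (min n m) →₀ ℕ}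
    (h : monomial e (1 : ℤ) ∈ minorsIdeal r (symPowMatrix d (diagIndetMatrix n m))) :
    ∏ j : Fin (min n m), y j ^ e j ∈ minorsIdeal r (symPowMatrix d (natDiagMatrix n m y)) := by
  rw [natDiagMatrix_eq_map, ← map_symPowMatrix, ← map_minorsIdeal]
  have := Ideal.mem_map_of_mem (eval₂Hom (Int.castRingHom R) fun i : Fin (min n m) => y i) h
  rw [coe_eval₂Hom, eval₂_monomial, Finsupp.prod_fintype _ _ fun _ => pow_zero _] at this
  simpa using this

/-- Permuting the diagonal entries gives a two-sided multiple. -/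
theorem isTwoSidedMul_natDiagMatrix_perm (π : Equiv.Perm (Fin (min n m))) (y z : ℕ → R)
    (h : ∀ i : Fin (min n m), z i = y (π i)) :
    IsTwoSidedMul (natDiagMatrix n m y) (natDiagMatrix n m z) := by
  have hlt : ∀ a : Fin (min n m), (a : ℕ) < n ∧ (a : ℕ) < m := fun a => lt_min_iff.1 a.isLt
  let f : Fin n → Fin n := fun i =>
    if hi : (i : ℕ) < min n m then ⟨π ⟨i, hi⟩, (hlt _).1⟩ else i
  let g : Fin m → Fin m := fun i =>
    if hi : (i : ℕ) < min n m then ⟨π ⟨i, hi⟩, (hlt _).2⟩ else i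
  have : natDiagMatrix n m z = (natDiagMatrix n m y).submatrix f g := by
    ext i j
    simp only [natDiagMatrix, Matrix.submatrix_apply, f, g]
    by_cases hi : (i : ℕ) < min n m <;> by_cases hj : (j : ℕ) < min n m
    · have h1 : ((π ⟨i, hi⟩ : Fin (min n m)) : ℕ) = π ⟨j, hj⟩ ↔ (i : ℕ) = j := by
        rw [← Fin.ext_iff, π.injective.eq_iff, Fin.mk.injEq]
      simp only [hi, hj, dif_pos, h1]
      rw [← h]
    · have h1 : (i : ℕ) ≠ j := by omega
      have h2 : ((π ⟨i, hi⟩ : Fin (min n m)) : ℕ) ≠ j := by have := (π ⟨i, hi⟩).isLt; omega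
      simp [hi, hj, h1, h2]
    · have h1 : (i : ℕ) ≠ j := by omega
      have h2 : (i : ℕ) ≠ (π ⟨j, hj⟩ : Fin (min n m)) := by have := (π ⟨j, hj⟩).isLt; omega
      simp [hi, hj, h1, h2]
    · have h1 : (i : ℕ) ≠ j := by omega
      simp [hi, hj, h1]
  rw [this]
  exact isTwoSidedMul_submatrix _ _ _

theorem prod_mem_minorsIdeal_natDiagMatrix (y : ℕ → R) (S : Finset (Fin (min n m))) :
    ∏ j ∈ S, y j ∈ minorsIdeal S.card (natDiagMatrix n m y) := by
  have hlt : ∀ a : Fin (min n m), (a : ℕ) < n ∧ (a : ℕ) < m := fun a => lt_min_iff.1 a.isLt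
  have h := det_submatrix_mem_minorsIdeal (natDiagMatrix n m y)
    (fun i : Fin S.card => (⟨S.orderEmbOfFin rfl i, (hlt _).1⟩ : Fin n))
    (fun i : Fin S.card => (⟨S.orderEmbOfFin rfl i, (hlt _).2⟩ : Fin m))
  have hdiag : (natDiagMatrix n m y).submatrix
      (fun i : Fin S.card => (⟨S.orderEmbOfFin rfl i, (hlt _).1⟩ : Fin n))
      (fun i : Fin S.card => (⟨S.orderEmbOfFin rfl i, (hlt _).2⟩ : Fin m)) =
      Matrix.diagonal fun i => y (S.orderEmbOfFin rfl i) := by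
    ext i j
    have h1 : ((S.orderEmbOfFin rfl i : Fin (min n m)) : ℕ) = S.orderEmbOfFin rfl j ↔ i = j := by
      rw [← Fin.ext_iff, (S.orderEmbOfFin rfl).injective.eq_iff]
    simp [natDiagMatrix, Matrix.diagonal_apply, h1]
  rw [hdiag, Matrix.det_diagonal] at h
  rw [← Finset.prod_coe_sort S, ← (S.orderIsoOfFin rfl).toEquiv.prod_comp]
  exact h

theorem prod_pow_mem_prodMinorsIdeal_natDiagMatrix (y : ℕ → R) (e : Fin (min n m) →₀ ℕ) :
    ∏ j : Fin (min n m), y j ^ e j ∈ prodMinorsIdeal (natDiagMatrix n m y) (monomialShape e) := by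
  rw [prodMinorsIdeal, prod_map_monomialShape _ _ (by rw [minorsIdeal_zero, Ideal.one_eq_top]),
    prod_pow_eq_prod_range e fun j : Fin (min n m) => y j]
  exact Ideal.prod_mem_prod fun i _ => prod_mem_minorsIdeal_natDiagMatrix y _

theorem minorsIdeal_natDiagMatrix_le (d : ℕ → R) (hd : ∀ i, d i ∣ d (i + 1)) (t : ℕ) :
    minorsIdeal t (natDiagMatrix n m d) ≤ Ideal.span {∏ j ∈ Finset.range t, d j} := by
  refine minorsIdeal_le fun r c => ?_
  by_cases hr : Function.Injective r
  · rw [Matrix.det_apply]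
    refine Ideal.sum_mem _ fun s _ => ?_
    rw [Units.smul_def]
    refine zsmul_mem ?_ _
    rw [Ideal.mem_span_singleton]
    by_cases h : ∀ i, (r (s i) : ℕ) = c i
    · have hinj : Function.Injective fun i => (r (s i) : ℕ) :=
        Fin.val_injective.comp (hr.comp s.injective)
      have := prod_range_card_dvd_prod d hd (Finset.univ.image fun i => (r (s i) : ℕ))
      rw [Finset.prod_image fun a _ b _ hab => hinj hab, Finset.card_image_of_injective _ hinj,
        Finset.card_univ, Fintype.card_fin] at this
      simpa [natDiagMatrix, h] using this
    · push Not at h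
      obtain ⟨i, hi⟩ := h
      rw [Finset.prod_eq_zero (Finset.mem_univ i) (by simp [natDiagMatrix, hi])]
      exact dvd_zero _
  · rw [Function.Injective] at hr
    push Not at hr
    obtain ⟨i, j, hij, hne⟩ := hr
    rw [Matrix.det_zero_of_row_eq hne (by ext k; simp [hij])]
    exact Ideal.zero_mem _

theorem prodMinorsIdeal_natDiagMatrix_le (d : ℕ → R) (hd : ∀ i, d i ∣ d (i + 1))
    (τ : Multiset ℕ) : prodMinorsIdeal (natDiagMatrix n m d) τ ≤
      Ideal.span {(τ.map fun s => ∏ j ∈ Finset.range s, d j).prod} := by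
  rw [prodMinorsIdeal]
  induction τ using Multiset.induction with
  | empty => simp
  | cons s τ ih =>
    rw [Multiset.map_cons, Multiset.prod_cons, Multiset.map_cons, Multiset.prod_cons,
      ← Ideal.span_singleton_mul_span_singleton]
    exact Ideal.mul_mono (minorsIdeal_natDiagMatrix_le d hd s) ih

/-- The ideal `Σ_{σ ∈ Σ} I^{(σ)}(φ)`. -/
def minimalShapesIdeal (d r : ℕ) (A : Matrix (Fin n) (Fin m) R) : Ideal R :=
  ⨆ σ ∈ minimalShapes n m d r, sumProdMinorsIdeal A σ

theorem map_minimalShapesIdeal {S : Type*} [CommRing S] (f : R →+* S) (d r : ℕ)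
    (A : Matrix (Fin n) (Fin m) R) :
    (minimalShapesIdeal d r A).map f = minimalShapesIdeal d r (A.map f) := by
  simp only [minimalShapesIdeal, Ideal.map_iSup, map_sumProdMinorsIdeal]

theorem minimalShapesIdeal_le {d r : ℕ} {A : Matrix (Fin n) (Fin m) R} {I : Ideal R}
    (h : ∀ σ ∈ shapesOfSymPowMinors n m d r, ∀ τ, YoungLE σ τ → prodMinorsIdeal A τ ≤ I) :
    minimalShapesIdeal d r A ≤ I :=
  iSup₂_le fun σ hσ => iSup₂_le fun τ hτ => h σ hσ.1 τ hτ.2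

theorem prodMinorsIdeal_le_minimalShapesIdeal {d r : ℕ} (A : Matrix (Fin n) (Fin m) R)
    {τ : Multiset ℕ} (hτ : τ ∈ shapesOfSymPowMinors n m d r) :
    prodMinorsIdeal A τ ≤ minimalShapesIdeal d r A := by
  have hY : ∀ σ ∈ shapesOfSymPowMinors n m d r, IsYoungDiagram σ := by
    rintro _ ⟨e, -, rfl⟩
    exact isYoungDiagram_monomialShape e
  obtain ⟨σ, hσ, hστ, hmin⟩ := exists_minimal_youngLE hY hτ
  exact le_trans (le_iSup₂_of_le τ ⟨hY τ hτ, hστ⟩ le_rfl)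
    (le_iSup₂_of_le (f := fun σ (_ : σ ∈ minimalShapes n m d r) => sumProdMinorsIdeal A σ)
      σ ⟨hσ, hmin⟩ le_rfl)

theorem IsTwoSidedMul.minimalShapesIdeal_le {n : ℕ} {m : ℕ} {A B : Matrix (Fin n) (Fin m) R}
    (h : IsTwoSidedMul A B) (d r : ℕ) : minimalShapesIdeal d r B ≤ minimalShapesIdeal d r A :=
  iSup₂_mono fun _ _ => iSup₂_mono fun _ _ => prodMinorsIdeal_mono h.minorsIdeal_le _

theorem minorsIdeal_symPowMatrix_natDiagMatrix_le_minimalShapesIdeal (d r : ℕ) (y : ℕ → R) :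
    minorsIdeal r (symPowMatrix d (natDiagMatrix n m y)) ≤
      minimalShapesIdeal d r (natDiagMatrix n m y) :=
  minorsIdeal_symPowMatrix_natDiagMatrix_le y fun e he =>
    prodMinorsIdeal_le_minimalShapesIdeal _ ⟨e, he, rfl⟩
      (prod_pow_mem_prodMinorsIdeal_natDiagMatrix y e)

theorem minimalShapesIdeal_natDiagMatrix_le (d r : ℕ) (q : ℕ → R) :
    minimalShapesIdeal d r (natDiagMatrix n m fun i => ∏ l ∈ Finset.range (i + 1), q l) ≤
      minorsIdeal r
        (symPowMatrix d (natDiagMatrix n m fun i => ∏ l ∈ Finset.range (i + 1), q l)) := by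
  refine minimalShapesIdeal_le ?_
  rintro _ ⟨e, he, rfl⟩ τ hτ
  refine (prodMinorsIdeal_natDiagMatrix_le _ (fun i => ?_) τ).trans ?_
  · rw [Finset.prod_range_succ _ (i + 1)]
    exact dvd_mul_right _ _
  · rw [Ideal.span_singleton_le_iff_mem]
    refine Ideal.mem_of_dvd _ (youngLE_prod_dvd q hτ) ?_
    obtain ⟨π, hπ⟩ := exists_perm_prod_pow_eq (M := R) e
    rw [← hπ]
    obtain ⟨z, hz⟩ : ∃ z : ℕ → R, ∀ i : Fin (min n m),
        z i = ∏ l ∈ Finset.range (π i + 1), q l :=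
      ⟨fun i => if hi : i < min n m then ∏ l ∈ Finset.range (π ⟨i, hi⟩ + 1), q l else 0,
        fun i => dif_pos i.isLt⟩
    simp only [← hz]
    exact (isTwoSidedMul_natDiagMatrix_perm π _ z hz).minorsIdeal_symPowMatrix_le r d
      (prod_pow_mem_minorsIdeal_symPowMatrix z he)

/-- Over a valuation ring, the two ideals coincide. -/
theorem ValuationRing.minorsIdeal_symPowMatrix_eq [IsDomain R] [ValuationRing R] (d r : ℕ)
    (A : Matrix (Fin n) (Fin m) R) :
    minorsIdeal r (symPowMatrix d A) = minimalShapesIdeal d r A := by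
  obtain ⟨q, h₁, h₂⟩ := exists_natDiagMatrix A
  apply le_antisymm
  · exact (h₂.minorsIdeal_symPowMatrix_le r d).trans
      ((minorsIdeal_symPowMatrix_natDiagMatrix_le_minimalShapesIdeal d r _).trans
        (h₁.minimalShapesIdeal_le d r))
  · exact (h₂.minimalShapesIdeal_le d r).trans
      ((minimalShapesIdeal_natDiagMatrix_le d r q).trans (h₁.minorsIdeal_symPowMatrix_le r d))

end Diagonal

/-! ### Integral closure of ideals -/

section IntClosure

variable {R S : Type*} [CommRing R] [CommRing S]

theorem Ideal.map_mem_intClosure (f : R →+* S) {I : Ideal R} {x : R} (hx : x ∈ I.intClosure) :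
    f x ∈ (I.map f).intClosure := by
  obtain ⟨k, hk, a, ha, h⟩ := hx
  refine ⟨k, hk, fun i => f (a i), fun i hi => ?_, ?_⟩
  · rw [← Ideal.map_pow]
    exact Ideal.mem_map_of_mem f (ha i hi)
  · simpa using congrArg f h

open Polynomial in
theorem Ideal.mem_intClosure_iff_isIntegral {I : Ideal R} {x : R} :
    x ∈ I.intClosure ↔ IsIntegral (reesAlgebra I) (monomial 1 x : R[X]) := by
  constructor
  · rintro ⟨k, hk, a, ha, h⟩
    have hmem : ∀ i, monomial i (if i ∈ Finset.Icc 1 k then a i else 0) ∈ reesAlgebra I := by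
      intro i
      split_ifs with hi
      · exact reesAlgebra.monomial_mem.2 (ha i hi)
      · simp
    let b : ℕ → reesAlgebra I := fun i => ⟨_, hmem i⟩
    refine ⟨X ^ k + ∑ i ∈ Finset.Icc 1 k, C (b i) * X ^ (k - i), ?_, ?_⟩
    · refine monic_X_pow_add (mem_degreeLT.1 (Submodule.sum_mem _ fun i hi => ?_))
      refine mem_degreeLT.2 ((degree_C_mul_X_pow_le _ _).trans_lt ?_)
      have := Finset.mem_Icc.1 hi
      exact_mod_cast (by omega : k - i < k)
    · simp only [eval₂_add, eval₂_pow, eval₂_X, eval₂_finsetSum, eval₂_mul, eval₂_C]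
      have : ∀ i ∈ Finset.Icc 1 k, algebraMap (reesAlgebra I) R[X] (b i) *
          (monomial 1 x) ^ (k - i) = monomial k (a i * x ^ (k - i)) := by
        intro i hi
        have hb : algebraMap (reesAlgebra I) R[X] (b i) = monomial i (a i) := by
          change monomial i (if i ∈ Finset.Icc 1 k then a i else 0) = _
          rw [if_pos hi]
        have hi' := Finset.mem_Icc.1 hi
        rw [hb, monomial_pow, monomial_mul_monomial, one_mul, Nat.add_sub_cancel' hi'.2]
      rw [Finset.sum_congr rfl this, ← map_sum, monomial_pow, one_mul, ← map_add, h, map_zero]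
  · rintro ⟨p, hp, h⟩
    obtain ⟨k, hk⟩ : ∃ k, k = p.natDegree := ⟨_, rfl⟩
    have hsum : ∑ i ∈ Finset.range (k + 1), ((p.coeff i : R[X]).coeff (k - i)) * x ^ i = 0 := by
      have := congrArg (fun q : R[X] => q.coeff k) h
      simp only [eval₂_eq_sum_range, finsetSum_coeff, coeff_zero, ← hk] at this
      rw [← this]
      refine Finset.sum_congr rfl fun i hi => ?_
      rw [monomial_pow, one_mul]
      have hik : i ≤ k := Nat.lt_succ_iff.1 (Finset.mem_range.1 hi)
      have hcoeff := coeff_mul_monomial (p.coeff i : R[X]) i (k - i) (x ^ i)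
      rw [Nat.sub_add_cancel hik] at hcoeff
      exact hcoeff.symm
    refine ⟨k + 1, k.succ_pos, fun i => if i ≤ k then (p.coeff (k - i) : R[X]).coeff i else 0,
      fun i hi => ?_, ?_⟩
    · dsimp only
      split_ifs
      · exact (mem_reesAlgebra_iff _ _).1 (p.coeff (k - i)).2 i
      · exact Ideal.zero_mem _
    · have h1 : ∑ i ∈ Finset.range (k + 1), (p.coeff (k - i) : R[X]).coeff i * x ^ (k - i) = 0 := by
        rw [← hsum, ← Finset.sum_range_reflect]
        refine Finset.sum_congr rfl fun i hi => ?_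
        have hik : i ≤ k := Nat.lt_succ_iff.1 (Finset.mem_range.1 hi)
        rw [show k + 1 - 1 - i = k - i by omega, Nat.sub_sub_self hik]
      rw [Finset.sum_range_succ'] at h1
      have hlead : (p.coeff (k - 0) : R[X]).coeff 0 = 1 := by
        rw [Nat.sub_zero, hk, hp.coeff_natDegree]
        simp
      rw [hlead, one_mul, Nat.sub_zero] at h1
      dsimp only
      rw [← Finset.Ico_add_one_right_eq_Icc, Finset.sum_Ico_eq_sum_range,
        show k + 1 + 1 - 1 = k + 1 by omega, Finset.sum_range_succ,
        if_neg (by omega : ¬ 1 + k ≤ k), zero_mul, add_zero]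
      have h2 := congrArg (fun z => z * x) h1
      simp only [add_mul, Finset.sum_mul, zero_mul] at h2
      rw [← h2, add_comm, pow_succ]
      congr 1
      refine Finset.sum_congr rfl fun i hi => ?_
      have hik : i < k := Finset.mem_range.1 hi
      rw [if_pos (by omega), mul_assoc, ← pow_succ, add_comm 1 i,
        show k + 1 - (i + 1) = k - (i + 1) + 1 by omega]

open Polynomial in
/-- Integral closure is idempotent and monotone. -/
theorem Ideal.intClosure_subset_of_subset {I J : Ideal R} (h : (I : Set R) ⊆ J.intClosure) :
    I.intClosure ⊆ J.intClosure := by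
  intro x hx
  rw [mem_intClosure_iff_isIntegral] at hx ⊢
  have hle : ∀ y ∈ reesAlgebra I, y ∈ integralClosure (reesAlgebra J) R[X] := by
    let T : Subalgebra R R[X] := (integralClosure (reesAlgebra J) R[X]).restrictScalars R
    have : reesAlgebra I ≤ T := by
      rw [← adjoin_monomial_eq_reesAlgebra, Algebra.adjoin_le_iff]
      rintro _ ⟨y, hy, rfl⟩
      exact mem_intClosure_iff_isIntegral.1 (h hy)
    exact this
  have hx' : IsIntegral (integralClosure (reesAlgebra J) R[X]) (monomial 1 x : R[X]) := by
    obtain ⟨p, hp, hpx⟩ := hx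
    let f : reesAlgebra I →+* integralClosure (reesAlgebra J) R[X] :=
      (algebraMap (reesAlgebra I) R[X]).codRestrict _ fun y => hle y y.2
    refine ⟨p.map f, hp.map f, ?_⟩
    rw [eval₂_map]
    exact hpx
  exact isIntegral_trans (R := reesAlgebra J) _ hx'

theorem Ideal.intClosure_eq_of_subset {I J : Ideal R} (hIJ : (I : Set R) ⊆ J.intClosure)
    (hJI : (J : Set R) ⊆ I.intClosure) : I.intClosure = J.intClosure :=
  (intClosure_subset_of_subset hIJ).antisymm (intClosure_subset_of_subset hJI)

theorem Ideal.map_subset_intClosure (f : R →+* S) {I J : Ideal R}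
    (h : (I : Set R) ⊆ J.intClosure) : (I.map f : Set S) ⊆ (J.map f).intClosure := by
  intro y hy
  rw [SetLike.mem_coe, Ideal.map] at hy
  induction hy using Submodule.span_induction with
  | mem y hy =>
    obtain ⟨x, hx, rfl⟩ := hy
    exact map_mem_intClosure f (h hx)
  | zero =>
    rw [mem_intClosure_iff_isIntegral, Polynomial.monomial_zero_right]
    exact isIntegral_zero
  | add y z _ _ hy hz =>
    rw [mem_intClosure_iff_isIntegral] at hy hz ⊢
    rw [map_add]
    exact hy.add hz
  | smul a y _ hy =>
    rw [mem_intClosure_iff_isIntegral] at hy ⊢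
    rw [smul_eq_mul, ← Polynomial.C_mul_monomial]
    exact (isIntegral_algebraMap (x := algebraMap S (reesAlgebra (J.map f)) a)).mul hy

open Polynomial in
/-- The valuative criterion for integral dependence over an ideal of a domain. -/
theorem Ideal.mem_intClosure_of_forall_valuationSubring [IsDomain R] {I : Ideal R} {x : R}
    (h : ∀ (V : ValuationSubring (FractionRing R)) (f : R →+* V),
      (∀ a, (f a : FractionRing R) = algebraMap R (FractionRing R) a) → f x ∈ I.map f) :
    x ∈ I.intClosure := by
  obtain rfl | hx0 := eq_or_ne x 0
  · exact ⟨1, one_pos, 0, fun i _ => Ideal.zero_mem _, by simp⟩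
  let K := FractionRing R
  let ι : R →+* K := algebraMap R K
  have hι : Function.Injective ι := IsFractionRing.injective R K
  have hιx : ι x ≠ 0 := fun h0 => hx0 (hι (h0.trans (map_zero ι).symm))
  let g : reesAlgebra I →+* K :=
    (eval₂RingHom ι (ι x)⁻¹).comp (reesAlgebra I).toSubring.subtype
  let P : Ideal (reesAlgebra I) :=
    RingHom.ker ((constantCoeff : R[X] →+* R).comp (reesAlgebra I).toSubring.subtype)
  by_cases hP : P.map g.rangeRestrict = ⊤
  · have h1 : (1 : g.range) ∈ P.map g.rangeRestrict := hP ▸ Submodule.mem_top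
    obtain ⟨p, hp, hp1⟩ := (Ideal.mem_map_iff_of_surjective _ g.rangeRestrict_surjective).1 h1
    have hp0 : (p : R[X]).coeff 0 = 0 := hp
    have hpe : (p : R[X]).eval₂ ι (ι x)⁻¹ = 1 := congrArg Subtype.val hp1
    obtain ⟨k, hk⟩ : ∃ k, k = (p : R[X]).natDegree := ⟨_, rfl⟩
    refine ⟨k + 1, k.succ_pos, fun i => -(p : R[X]).coeff i,
      fun i _ => neg_mem ((mem_reesAlgebra_iff _ _).1 p.2 i), hι ?_⟩
    rw [eval₂_eq_sum_range' ι (n := k + 2) (by omega), Finset.sum_range_succ', hp0, map_zero,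
      zero_mul, add_zero] at hpe
    rw [← Finset.Ico_add_one_right_eq_Icc, Finset.sum_Ico_eq_sum_range,
      show k + 1 + 1 - 1 = k + 1 by omega]
    have h2 := congrArg (fun z => z * ι x ^ (k + 1)) hpe
    rw [one_mul] at h2
    simp only [map_add, map_pow, map_sum, map_mul, map_neg, map_zero]
    rw [← h2, Finset.sum_mul, ← Finset.sum_add_distrib]
    refine Finset.sum_eq_zero fun i hi => ?_
    have hik : i < k + 1 := Finset.mem_range.1 hi
    have hpow : ι x ^ (k + 1) = ι x ^ (i + 1) * ι x ^ (k + 1 - (1 + i)) := by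
      rw [← pow_add]
      congr 1
      omega
    rw [hpow, add_comm 1 i, inv_pow, mul_assoc, inv_mul_cancel_left₀ (pow_ne_zero _ hιx)]
    ring
  · obtain ⟨V, hV, hPV⟩ := Ideal.image_subset_nonunits_valuationSubring _ hP
    have hιV : ∀ a, ι a ∈ V := fun a =>
      hV ⟨algebraMap R (reesAlgebra I) a, by simp [g, ι, K]⟩
    have hmem := h V (ι.codRestrict V hιV) fun _ => rfl
    have hlt : ∀ v : V, v ∈ I.map (ι.codRestrict V hιV) →
        V.valuation ((v : K) / ι x) < 1 := by
      intro v hv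
      rw [Ideal.map] at hv
      induction hv using Submodule.span_induction with
      | mem v hv =>
        obtain ⟨a, ha, rfl⟩ := hv
        rw [← ValuationSubring.mem_nonunits_iff]
        refine hPV ⟨g.rangeRestrict ⟨monomial 1 a, reesAlgebra.monomial_mem.2 (by simpa using ha)⟩,
          Ideal.mem_map_of_mem _ ?_, ?_⟩
        · simp [P, RingHom.mem_ker]
        · change (monomial 1 a).eval₂ ι (ι x)⁻¹ = ι a / ι x
          rw [eval₂_monomial, pow_one, div_eq_mul_inv]
      | zero => simp
      | add v w _ _ hv hw =>
        rw [Subring.coe_add, add_div]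
        exact Valuation.map_add_lt _ hv hw
      | smul a v _ hv =>
        rw [smul_eq_mul, Subring.coe_mul, mul_div_assoc, map_mul]
        exact mul_lt_one_of_nonneg_of_lt_one_right ((V.valuation_le_one_iff _).2 a.2) zero_le hv
    have := hlt _ hmem
    rw [show ((ι.codRestrict V hιV x : V) : K) = ι x from rfl, div_self hιx, map_one] at this
    exact absurd this (lt_irrefl _)

end IntClosure

/-- Over a domain, each of the two ideals is integral over the other. -/
theorem minorsIdeal_symPowMatrix_subset_intClosure {A : Type*} [CommRing A] [IsDomain A]
    {n m : ℕ} (d r : ℕ) (X : Matrix (Fin n) (Fin m) A) :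
    (minorsIdeal r (symPowMatrix d X) : Set A) ⊆ (minimalShapesIdeal d r X).intClosure ∧
      (minimalShapesIdeal d r X : Set A) ⊆ (minorsIdeal r (symPowMatrix d X)).intClosure := by
  have key : ∀ (V : ValuationSubring (FractionRing A)) (f : A →+* V),
      (minorsIdeal r (symPowMatrix d X)).map f = (minimalShapesIdeal d r X).map f := by
    intro V f
    rw [map_minorsIdeal, map_symPowMatrix, map_minimalShapesIdeal,
      ValuationRing.minorsIdeal_symPowMatrix_eq]
  constructor
  · exact fun x hx => Ideal.mem_intClosure_of_forall_valuationSubring fun V f _ =>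
      key V f ▸ Ideal.mem_map_of_mem f hx
  · exact fun x hx => Ideal.mem_intClosure_of_forall_valuationSubring fun V f _ =>
      (key V f).symm ▸ Ideal.mem_map_of_mem f hx

/-- Let `R` be a commutative ring, `φ : R^m → R^n` a linear map, `d ≥ 1`, `r ≥ 1`, and `Σ`
the set of minimal shapes of monomials of `I_r(S^d(Y))` for a diagonal matrix `Y` of
indeterminates of the same format. Then the ideals `I_r(S^d(φ))` and
`Σ_{σ ∈ Σ} I^{(σ)}(φ)` have the same integral closure. -/
theorem intClosure_minors_symPow {R : Type*} [CommRing R] {m n : ℕ}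
    (φ : Matrix (Fin n) (Fin m) R) (d r : ℕ) (hd : 1 ≤ d) (hr : 1 ≤ r) :
    (minorsIdeal r (symPowMatrix d φ)).intClosure =
      (⨆ σ ∈ minimalShapes n m d r, sumProdMinorsIdeal φ σ).intClosure := by
  let X : Matrix (Fin n) (Fin m) (MvPolynomial (Fin n × Fin m) ℤ) :=
    fun i j => MvPolynomial.X (i, j)
  let f : MvPolynomial (Fin n × Fin m) ℤ →+* R :=
    MvPolynomial.eval₂Hom (Int.castRingHom R) fun x => φ x.1 x.2
  have hX : X.map f = φ := by
    ext i j
    exact MvPolynomial.eval₂_X _ _ _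
  obtain ⟨h₁, h₂⟩ := minorsIdeal_symPowMatrix_subset_intClosure d r X
  have h₁' := Ideal.map_subset_intClosure f h₁
  have h₂' := Ideal.map_subset_intClosure f h₂
  rw [map_minorsIdeal, map_symPowMatrix, map_minimalShapesIdeal, hX] at h₁' h₂'
  exact Ideal.intClosure_eq_of_subset h₁' h₂'
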